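/- Let λ ∈ ℝ and let G_λ be the compactified exponential-potential vector field on ℝ³ with components Ẋ₂ = −(λ/√2)X₂Y₁𝓘 + Y₁²(X₂(2X₂+X₃) − 1) − X₂X₃(X₂(3X₂+X₃) − 2), Ẋ₃ = −(λ/√2)X₃Y₁𝓘 − 3X₂²X₃² + 2X₂² − X₂X₃³ + X₃Y₁²(2X₂+X₃) + X₂X₃ + X₃² − 1, Ẏ₁ = (λ/√2)(1 − Y₁²)𝓘 − X₂Y₁(3X₂X₃ + X₃² + 1) + Y₁³(2X₂+X₃), where 𝓘(X₂,X₃) = 2X₂² + 2X₂X₃ + X₃² − 1. Then the directional derivative of 𝓘 along G_λ satisfies, identically on ℝ³, ∇𝓘 · G_λ = 𝓘 · [ −√2 λ Y₁ (2X₂² + 2X₂X₃ + X₃²) − 2X₂(3X₂X₃ + X₃² − 1) + 2Y₁²(2X₂+X₃) + 2X₃ ]. Consequently the surface 𝓘 = 0 is an invariant submanifold of the flow. -/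

import Mathlib

/-- For the compactified exponential-potential vector field `G_λ` on `ℝ³`, the
directional derivative of `𝓘 = 2X₂² + 2X₂X₃ + X₃² − 1` along `G_λ` equals
`𝓘·[−√2 λ Y₁(2X₂² + 2X₂X₃ + X₃²) − 2X₂(3X₂X₃ + X₃² − 1) + 2Y₁²(2X₂+X₃) + 2X₃]`
identically; consequently the surface `𝓘 = 0` is invariant (the derivative of `𝓘`
along the flow vanishes wherever `𝓘 = 0`). -/
theorem stmt10 (lam : ℝ) (II : ℝ × ℝ × ℝ → ℝ)
    (hII : ∀ p : ℝ × ℝ × ℝ,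
      II p = 2 * p.1 ^ 2 + 2 * p.1 * p.2.1 + p.2.1 ^ 2 - 1)
    (G : ℝ × ℝ × ℝ → ℝ × ℝ × ℝ)
    (hG : ∀ p : ℝ × ℝ × ℝ, G p =
      (-(lam / Real.sqrt 2) * p.1 * p.2.2 * II p
          + p.2.2 ^ 2 * (p.1 * (2 * p.1 + p.2.1) - 1)
          - p.1 * p.2.1 * (p.1 * (3 * p.1 + p.2.1) - 2),
        -(lam / Real.sqrt 2) * p.2.1 * p.2.2 * II p
          - 3 * p.1 ^ 2 * p.2.1 ^ 2 + 2 * p.1 ^ 2 - p.1 * p.2.1 ^ 3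
          + p.2.1 * p.2.2 ^ 2 * (2 * p.1 + p.2.1) + p.1 * p.2.1 + p.2.1 ^ 2 - 1,
        (lam / Real.sqrt 2) * (1 - p.2.2 ^ 2) * II p
          - p.1 * p.2.2 * (3 * p.1 * p.2.1 + p.2.1 ^ 2 + 1)
          + p.2.2 ^ 3 * (2 * p.1 + p.2.1))) :
    (∀ p : ℝ × ℝ × ℝ,
      fderiv ℝ II p (G p) =
        II p * (-(Real.sqrt 2) * lam * p.2.2 * (2 * p.1 ^ 2 + 2 * p.1 * p.2.1 + p.2.1 ^ 2)
          - 2 * p.1 * (3 * p.1 * p.2.1 + p.2.1 ^ 2 - 1)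
          + 2 * p.2.2 ^ 2 * (2 * p.1 + p.2.1) + 2 * p.2.1)) ∧
    (∀ p : ℝ × ℝ × ℝ, II p = 0 → fderiv ℝ II p (G p) = 0) := by
  have hderiv (p : ℝ × ℝ × ℝ) : fderiv ℝ II p (G p) =
      (4 * p.1 + 2 * p.2.1) * (G p).1 + (2 * p.1 + 2 * p.2.1) * (G p).2.1 := by
    have hfst : HasFDerivAt (fun q : ℝ × ℝ × ℝ => q.1) (.fst ℝ ℝ (ℝ × ℝ)) p := hasFDerivAt_fst
    have hsnd : HasFDerivAt (fun q : ℝ × ℝ × ℝ => q.2.1)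
        ((ContinuousLinearMap.fst ℝ ℝ ℝ).comp (.snd ℝ ℝ (ℝ × ℝ))) p :=
      hasFDerivAt_fst.comp p hasFDerivAt_snd
    have h := ((((hfst.pow 2).const_mul 2).add ((hfst.const_mul 2).mul hsnd)).add
      (hsnd.pow 2)).sub_const 1
    rw [(h.congr_of_eventuallyEq (.of_forall hII)).fderiv]
    simp
    ring
  have hmain (p : ℝ × ℝ × ℝ) : fderiv ℝ II p (G p) =
      II p * (-(Real.sqrt 2) * lam * p.2.2 * (2 * p.1 ^ 2 + 2 * p.1 * p.2.1 + p.2.1 ^ 2)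
        - 2 * p.1 * (3 * p.1 * p.2.1 + p.2.1 ^ 2 - 1)
        + 2 * p.2.2 ^ 2 * (2 * p.1 + p.2.1) + 2 * p.2.1) := by
    have hsqrt : Real.sqrt 2 * lam = 2 * (lam / Real.sqrt 2) := by
      field_simp
      rw [Real.sq_sqrt zero_le_two, mul_comm]
    rw [hderiv, hG, neg_mul √2, hsqrt, hII]
    ring
  exact ⟨hmain, fun p hp => by rw [hmain, hp, zero_mul]⟩
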